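/- Let Λⁿ = [−1,1]ⁿ with faces Λₖ± as usual. If p : Λⁿ → Λⁿ is continuous and p(Λₖ⁻) ⊆ Λₖ⁻ and p(Λₖ⁺) ⊆ Λₖ⁺ for every 1 ≤ k ≤ n, then p is surjective. -/

import Mathlib

open Set

/-- Mod 2 cochains on the Freudenthal triangulation of `ℕ^ι`, recorded by the set of directions
used by a simplex and by its least vertex. -/
abbrev GridCochain (ι : Type*) : Type _ := Finset ι → (ι → ℕ) → ZMod 2

namespace GridCochain

variable {ι : Type*} [DecidableEq ι]

/-- Summing a cochain over the possible first steps of a simplex. -/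
def shift : Module.End (ZMod 2) (GridCochain ι) where
  toFun G S v := ∑ m ∈ S, G (S.erase m) (v + Pi.single m 1)
  map_add' G H := by ext S v; simp [Finset.sum_add_distrib]
  map_smul' c G := by ext S v; simp [Finset.mul_sum]

/-- Summing a cochain over the possible directions, without moving the least vertex. -/
def drop : Module.End (ZMod 2) (GridCochain ι) where
  toFun G S v := ∑ m ∈ S, G (S.erase m) v
  map_add' G H := by ext S v; simp [Finset.sum_add_distrib]
  map_smul' c G := by ext S v; simp [Finset.mul_sum]

omit [DecidableEq ι] in
/-- Multiplication by a function of the least vertex. -/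
def mulFun (f : (ι → ℕ) → ZMod 2) : Module.End (ZMod 2) (GridCochain ι) where
  toFun G S v := f v * G S v
  map_add' G H := by ext S v; simp [mul_add]
  map_smul' c G := by ext S v; simp [mul_left_comm]

/-- Left cup product with the coboundary of a function. -/
def coboundary (f : (ι → ℕ) → ZMod 2) : Module.End (ZMod 2) (GridCochain ι) :=
  shift * mulFun f + mulFun f * shift

/-- The unit cochain. -/
def unit : GridCochain ι := fun S _ => if S = ∅ then 1 else 0

/-- Left cup product with the coboundaries of the functions `F i`, for `i` in a list. -/
def cup (F : ι → (ι → ℕ) → ZMod 2) (l : List ι) : Module.End (ZMod 2) (GridCochain ι) :=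
  (l.map fun i => coboundary (F i)).prod

theorem coboundary_apply (f : (ι → ℕ) → ZMod 2) (G : GridCochain ι) (S : Finset ι) (v : ι → ℕ) :
    coboundary f G S v =
      ∑ m ∈ S, (f (v + Pi.single m 1) - f v) * G (S.erase m) (v + Pi.single m 1) := by
  simp [coboundary, shift, mulFun, CharTwo.sub_eq_add, add_mul, Finset.sum_add_distrib,
    Finset.mul_sum]

theorem shift_mul_shift : (shift * shift : Module.End (ZMod 2) (GridCochain ι)) = 0 := by
  ext G S v
  simp only [Module.End.mul_apply, shift, LinearMap.coe_mk, AddHom.coe_mk, LinearMap.zero_apply,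
    Pi.zero_apply]
  rw [Finset.sum_sigma']
  refine Finset.sum_involution (fun x _ => ⟨x.2, x.1⟩) ?_ ?_ ?_ ?_
  · rintro ⟨a, b⟩ h
    simp only
    rw [Finset.erase_right_comm, add_right_comm]
    exact CharTwo.add_self_eq_zero _
  · rintro ⟨a, b⟩ h _ heq
    simp at h heq
    exact h.2.1 heq.1
  · rintro ⟨a, b⟩ h
    simp at h ⊢
    exact ⟨h.2.2, fun e => h.2.1 e.symm, h.1⟩
  · rintro ⟨a, b⟩ h
    rfl

theorem commute_shift_coboundary (f : (ι → ℕ) → ZMod 2) : Commute shift (coboundary f) := by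
  have h := shift_mul_shift (ι := ι)
  simp only [Commute, SemiconjBy, coboundary, mul_add, add_mul, mul_assoc, h, mul_zero]
  simp only [← mul_assoc, h, zero_mul, zero_add, add_zero]

theorem commute_drop_shift : Commute (drop : Module.End (ZMod 2) (GridCochain ι)) shift := by
  ext G S v
  simp only [Module.End.mul_apply, shift, drop, LinearMap.coe_mk, AddHom.coe_mk]
  rw [Finset.sum_sigma', Finset.sum_sigma']
  refine Finset.sum_bij' (fun x _ => ⟨x.2, x.1⟩) (fun x _ => ⟨x.2, x.1⟩) ?_ ?_ ?_ ?_ ?_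
  · rintro ⟨a, b⟩ h
    simp at h ⊢
    exact ⟨h.2.2, fun e => h.2.1 e.symm, h.1⟩
  · rintro ⟨a, b⟩ h
    simp at h ⊢
    exact ⟨h.2.2, fun e => h.2.1 e.symm, h.1⟩
  · rintro ⟨a, b⟩ h
    rfl
  · rintro ⟨a, b⟩ h
    rfl
  · rintro ⟨a, b⟩ h
    simp only
    rw [Finset.erase_right_comm]

theorem commute_drop_mulFun (f : (ι → ℕ) → ZMod 2) : Commute drop (mulFun f) := by
  ext G S v
  simp [drop, mulFun, Finset.mul_sum]

theorem commute_drop_coboundary (f : (ι → ℕ) → ZMod 2) : Commute drop (coboundary f) :=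
  (commute_drop_shift.mul_right (commute_drop_mulFun f)).add_right
    ((commute_drop_mulFun f).mul_right commute_drop_shift)

theorem commute_cup {A : Module.End (ZMod 2) (GridCochain ι)}
    (hA : ∀ f, Commute A (coboundary f)) (F : ι → (ι → ℕ) → ZMod 2) (l : List ι) :
    Commute A (cup F l) := by
  refine Commute.list_prod_right _ _ fun x hx => ?_
  obtain ⟨i, -, rfl⟩ := List.mem_map.1 hx
  exact hA _

theorem shift_unit : shift (unit : GridCochain ι) = drop unit := rfl

/-- The Leibniz rule for a cup product with one distinguished factor. -/
theorem cup_mul_coboundary_mul_cup (F : ι → (ι → ℕ) → ZMod 2) (h : (ι → ℕ) → ZMod 2)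
    (l₁ l₂ : List ι) :
    (cup F l₁ * coboundary h * cup F l₂) unit =
      shift ((cup F l₁ * mulFun h * cup F l₂) unit) +
        drop ((cup F l₁ * mulFun h * cup F l₂) unit) := by
  have e₁ := (commute_cup commute_shift_coboundary F l₁).eq
  have e₂ := (commute_cup commute_shift_coboundary F l₂).eq
  have hd : Commute drop (cup F l₁ * mulFun h * cup F l₂) :=
    ((commute_cup commute_drop_coboundary F l₁).mul_right (commute_drop_mulFun h)).mul_right
      (commute_cup commute_drop_coboundary F l₂)
  have e : cup F l₁ * coboundary h * cup F l₂ =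
      shift * (cup F l₁ * mulFun h * cup F l₂) + (cup F l₁ * mulFun h * cup F l₂) * shift := by
    simp only [coboundary, mul_add, add_mul, mul_assoc, ← e₂]
    simp only [← mul_assoc, e₁]
  rw [e, LinearMap.add_apply, Module.End.mul_apply shift, Module.End.mul_apply _ shift,
    shift_unit, ← Module.End.mul_apply _ drop, ← hd.eq, Module.End.mul_apply drop]

/-- The cochain vanishes on all simplices contained in the hyperplane `x m = c`. -/
def VanishesOn (m : ι) (c : ℕ) (G : GridCochain ι) : Prop :=
  ∀ S v, m ∉ S → v m = c → G S v = 0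

theorem VanishesOn.coboundary {m : ι} {c : ℕ} {G : GridCochain ι} (hG : VanishesOn m c G)
    (f : (ι → ℕ) → ZMod 2) : VanishesOn m c (coboundary f G) := by
  intro S v hS hv
  rw [coboundary_apply]
  refine Finset.sum_eq_zero fun k hk => ?_
  have hkm : m ≠ k := fun e => hS (e ▸ hk)
  rw [hG _ _ (by simp [hS]) (by simp [hkm, hv]), mul_zero]

omit [DecidableEq ι] in
theorem VanishesOn.mulFun {m : ι} {c : ℕ} {G : GridCochain ι} (hG : VanishesOn m c G)
    (f : (ι → ℕ) → ZMod 2) : VanishesOn m c (mulFun f G) := by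
  intro S v hS hv
  simp [GridCochain.mulFun, hG S v hS hv]

theorem vanishesOn_coboundary {m : ι} {c : ℕ} {f : (ι → ℕ) → ZMod 2} {b : ZMod 2}
    (hf : ∀ v, v m = c → f v = b) (G : GridCochain ι) : VanishesOn m c (coboundary f G) := by
  intro S v hS hv
  rw [coboundary_apply]
  refine Finset.sum_eq_zero fun k hk => ?_
  have hkm : m ≠ k := fun e => hS (e ▸ hk)
  rw [hf v hv, hf _ (by simp [hkm, hv]), sub_self, zero_mul]

omit [DecidableEq ι] in
theorem vanishesOn_mulFun {m : ι} {c : ℕ} {f : (ι → ℕ) → ZMod 2}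
    (hf : ∀ v, v m = c → f v = 0) (G : GridCochain ι) : VanishesOn m c (mulFun f G) := by
  intro S v hS hv
  simp [GridCochain.mulFun, hf v hv]

theorem cup_cons (F : ι → (ι → ℕ) → ZMod 2) (i : ι) (l : List ι) :
    cup F (i :: l) = coboundary (F i) * cup F l := by
  simp [cup]

theorem cup_append (F : ι → (ι → ℕ) → ZMod 2) (l₁ l₂ : List ι) :
    cup F (l₁ ++ l₂) = cup F l₁ * cup F l₂ := by
  simp [cup]

theorem VanishesOn.cup {m : ι} {c : ℕ} {G : GridCochain ι} (hG : VanishesOn m c G)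
    (F : ι → (ι → ℕ) → ZMod 2) (l : List ι) : VanishesOn m c (cup F l G) := by
  induction l with
  | nil => simpa [GridCochain.cup] using hG
  | cons i l ih =>
    rw [cup_cons, Module.End.mul_apply]
    exact ih.coboundary _

theorem vanishesOn_cup {m : ι} {c : ℕ} {F : ι → (ι → ℕ) → ZMod 2} {b : ZMod 2}
    (hF : ∀ v, v m = c → F m v = b) {l : List ι} (hl : m ∈ l) (G : GridCochain ι) :
    VanishesOn m c (cup F l G) := by
  obtain ⟨l₁, l₂, rfl⟩ := List.append_of_mem hl
  rw [cup_append, cup_cons, Module.End.mul_apply, Module.End.mul_apply]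
  exact (vanishesOn_coboundary hF _).cup F l₁

theorem coboundary_add (f g : (ι → ℕ) → ZMod 2) :
    coboundary (f + g) = coboundary f + coboundary g := by
  refine LinearMap.ext fun G => funext₂ fun S v => ?_
  rw [LinearMap.add_apply, Pi.add_apply, Pi.add_apply, coboundary_apply, coboundary_apply,
    coboundary_apply, ← Finset.sum_add_distrib]
  refine Finset.sum_congr rfl fun m _ => ?_
  simp only [Pi.add_apply]
  ring

theorem cup_positive (l : List ι) (hl : l.Nodup) (S : Finset ι) (v : ι → ℕ) :
    cup (fun i w => if w i = 0 then 0 else 1) l unit S v =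
      if S = l.toFinset ∧ ∀ i ∈ l, v i = 0 then 1 else 0 := by
  induction l generalizing S v with
  | nil => simp [cup, unit]
  | cons i l ih =>
    obtain ⟨hi, hl⟩ := List.nodup_cons.1 hl
    rw [cup_cons, Module.End.mul_apply, coboundary_apply]
    have hne : ∀ k ∈ S, k ≠ i → ((if (v + Pi.single k 1 : ι → ℕ) i = 0 then (0 : ZMod 2) else 1) -
        if v i = 0 then 0 else 1) * cup (fun i w => if w i = 0 then 0 else 1) l unit (S.erase k)
          (v + Pi.single k 1) = 0 := by
      intro k _ hk
      simp [hk.symm]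
    by_cases hS : i ∈ S
    · rw [Finset.sum_eq_single_of_mem i hS hne, ih hl]
      have h1 : (∀ j ∈ l, (v + Pi.single i 1 : ι → ℕ) j = 0) ↔ ∀ j ∈ l, v j = 0 := by
        refine forall₂_congr fun j hj => ?_
        have : j ≠ i := fun e => hi (e ▸ hj)
        simp [this]
      have h2 : S.erase i = l.toFinset ↔ S = (i :: l).toFinset := by
        rw [List.toFinset_cons]
        constructor
        · intro e
          rw [← e, Finset.insert_erase hS]
        · rintro rfl
          exact Finset.erase_insert (by simpa using hi)
      simp only [h1, h2, List.forall_mem_cons]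
      by_cases hv : v i = 0 <;> simp [hv]
    · rw [Finset.sum_eq_zero fun k hk => hne k hk fun e => hS (e ▸ hk), if_neg]
      rintro ⟨rfl, -⟩
      simp at hS

theorem exists_ne_of_cup_ne_zero {F : ι → (ι → ℕ) → ZMod 2} {l : List ι} {S : Finset ι}
    {v : ι → ℕ} (h : cup F l unit S v ≠ 0) :
    ∀ i ∈ l, ∃ r s : ι → ℕ, (∀ k, v k ≤ r k ∧ r k ≤ v k + if k ∈ S then 1 else 0) ∧
      (∀ k, v k ≤ s k ∧ s k ≤ v k + if k ∈ S then 1 else 0) ∧ F i r ≠ F i s := by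
  induction l generalizing S v with
  | nil => simp
  | cons j l ih =>
    rw [cup_cons, Module.End.mul_apply, coboundary_apply] at h
    obtain ⟨m, hm, hne⟩ := Finset.exists_ne_zero_of_sum_ne_zero h
    have hstep : ∀ r : ι → ℕ, (∀ k, (v + Pi.single m 1 : ι → ℕ) k ≤ r k ∧
        r k ≤ (v + Pi.single m 1 : ι → ℕ) k + if k ∈ S.erase m then 1 else 0) →
        ∀ k, v k ≤ r k ∧ r k ≤ v k + if k ∈ S then 1 else 0 := by
      intro r hr k
      have := hr k
      by_cases hk : k = m
      · subst hk
        simp at this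
        simp [hm]
        omega
      · simpa [hk] using this
    intro i hi
    rcases List.mem_cons.1 hi with rfl | hi
    · refine ⟨v + Pi.single m 1, v, hstep _ fun k => by simp, fun k => by simp, ?_⟩
      exact sub_ne_zero.1 (left_ne_zero_of_mul hne)
    · obtain ⟨r, s, hr, hs, hrs⟩ := ih (right_ne_zero_of_mul hne) i hi
      exact ⟨r, s, hstep r hr, hstep s hs, hrs⟩

variable [Fintype ι]

theorem sum_box_add_single {N : ℕ} {m : ι} {φ : (ι → ℕ) → ZMod 2}
    (h0 : ∀ v, v m = 0 → φ v = 0) (hN : ∀ v, v m = N → φ v = 0) :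
    ∑ v ∈ Fintype.piFinset (fun _ : ι => Finset.range N), φ (v + Pi.single m 1) =
      ∑ v ∈ Fintype.piFinset (fun _ : ι => Finset.range N), φ v := by
  refine Finset.sum_bij_ne_zero (fun v _ _ => v + Pi.single m 1) ?_ ?_ ?_ ?_
  · intro v hv hne
    simp only [Fintype.mem_piFinset, Finset.mem_range] at hv ⊢
    intro k
    by_cases hk : k = m
    · subst hk
      have h1 : (v + Pi.single k 1 : ι → ℕ) k ≠ N := fun e => hne (hN _ e)
      have := hv k
      simp at h1 ⊢
      omega
    · simpa [hk] using hv k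
  · intro v _ _ w _ _ e
    exact add_right_cancel e
  · intro v hv hne
    have h1 : v m ≠ 0 := fun e => hne (h0 _ e)
    have e : v - Pi.single m 1 + Pi.single m 1 = v := by
      ext k
      by_cases hk : k = m
      · subst hk
        simp
        omega
      · simp [hk]
    refine ⟨v - Pi.single m 1, ?_, by rwa [e], e⟩
    simp only [Fintype.mem_piFinset, Finset.mem_range] at hv ⊢
    intro k
    exact lt_of_le_of_lt (Nat.sub_le _ _) (hv k)
  · intro v _ _
    rfl

/-- Evaluation of a top-dimensional cochain on the box `[0, N]^ι`. -/
def boxSum (N : ℕ) (G : GridCochain ι) : ZMod 2 :=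
  ∑ v ∈ Fintype.piFinset (fun _ : ι => Finset.range N), G Finset.univ v

theorem boxSum_shift_add_drop {N : ℕ} {G : GridCochain ι} (h0 : ∀ m, VanishesOn m 0 G)
    (hN : ∀ m, VanishesOn m N G) : boxSum N (shift G + drop G) = 0 := by
  simp only [boxSum, shift, drop, Pi.add_apply, LinearMap.coe_mk, AddHom.coe_mk]
  rw [Finset.sum_add_distrib, Finset.sum_comm, Finset.sum_comm (f := fun v m =>
    G (Finset.univ.erase m) v), ← Finset.sum_add_distrib]
  refine Finset.sum_eq_zero fun m _ => ?_
  rw [sum_box_add_single (φ := G (Finset.univ.erase m))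
    (fun v hv => h0 m _ v (by simp) hv) (fun v hv => hN m _ v (by simp) hv)]
  exact CharTwo.add_self_eq_zero _

/-- A labelling separating each pair of opposite faces of the box. -/
def Separates (N : ℕ) (F : ι → (ι → ℕ) → ZMod 2) : Prop :=
  ∀ i v, (v i = 0 → F i v = 0) ∧ (v i = N → F i v = 1)

theorem boxSum_cup_update {N : ℕ} {F : ι → (ι → ℕ) → ZMod 2} (hF : Separates N F) {i : ι}
    {g : (ι → ℕ) → ZMod 2} (hg : ∀ v, (v i = 0 → g v = 0) ∧ (v i = N → g v = 1))
    {l : List ι} (hl : l.Nodup) (hmem : ∀ i, i ∈ l) :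
    boxSum N (cup (Function.update F i g) l unit) = boxSum N (cup F l unit) := by
  obtain ⟨l₁, l₂, rfl⟩ := List.append_of_mem (hmem i)
  have hi : i ∉ l₁ ++ l₂ := (List.nodup_middle.1 hl).notMem
  have hupd : ∀ l', i ∉ l' → cup (Function.update F i g) l' = cup F l' := by
    intro l' hl'
    unfold cup
    congr 1
    refine List.map_congr_left fun j hj => ?_
    rw [Function.update_of_ne (ne_of_mem_of_not_mem hj hl')]
  set h := F i + g with h_def
  have hgF : g = F i + h := by
    ext v
    simp [h_def, ← add_assoc, CharTwo.add_self_eq_zero]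
  have key : cup (Function.update F i g) (l₁ ++ i :: l₂) =
      cup F (l₁ ++ i :: l₂) + cup F l₁ * coboundary h * cup F l₂ := by
    rw [cup_append, cup_append, cup_cons, cup_cons, hupd l₁ (fun e => hi (by simp [e])),
      hupd l₂ (fun e => hi (by simp [e])), Function.update_self]
    conv_lhs => rw [hgF, coboundary_add]
    simp only [mul_add, add_mul, mul_assoc]
  have h0 : ∀ v, v i = 0 → h v = 0 := by
    intro v hv
    simp [h_def, (hF i v).1 hv, (hg v).1 hv]
  have h1 : ∀ v, v i = N → h v = 0 := by
    intro v hv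
    simp [h_def, (hF i v).2 hv, (hg v).2 hv, CharTwo.add_self_eq_zero]
  have van : ∀ c, (∃ b : ι → ZMod 2, ∀ m v, v m = c → F m v = b m) →
      (∀ v, v i = c → h v = 0) →
      ∀ m, VanishesOn m c ((cup F l₁ * mulFun h * cup F l₂) unit) := by
    rintro c ⟨b, hb⟩ hc m
    rw [Module.End.mul_apply, Module.End.mul_apply]
    have hm := hmem m
    simp only [List.mem_append, List.mem_cons] at hm
    rcases hm with hm | rfl | hm
    · exact vanishesOn_cup (hb m) hm _
    · exact (vanishesOn_mulFun hc _).cup F l₁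
    · exact ((vanishesOn_cup (hb m) hm _).mulFun h).cup F l₁
  have hz := boxSum_shift_add_drop (van 0 ⟨fun _ => 0, fun m v => (hF m v).1⟩ h0)
    (van N ⟨fun _ => 1, fun m v => (hF m v).2⟩ h1)
  rw [← cup_mul_coboundary_mul_cup] at hz
  rw [key]
  unfold boxSum at hz ⊢
  simp only [LinearMap.add_apply, Pi.add_apply, Finset.sum_add_distrib]
  rw [hz, add_zero]

theorem boxSum_cup_eq {N : ℕ} {F F' : ι → (ι → ℕ) → ZMod 2} (hF : Separates N F)
    (hF' : Separates N F') {l : List ι} (hl : l.Nodup) (hmem : ∀ i, i ∈ l) :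
    boxSum N (cup F l unit) = boxSum N (cup F' l unit) := by
  have key : ∀ A : Finset ι,
      boxSum N (cup (fun i => if i ∈ A then F' i else F i) l unit) = boxSum N (cup F l unit) := by
    intro A
    induction A using Finset.induction_on with
    | empty => simp
    | insert i A _ ih =>
      have hA : Separates N fun j => if j ∈ A then F' j else F j := by
        intro j v
        simp only
        split_ifs
        exacts [hF' j v, hF j v]
      refine Eq.trans ?_ ((boxSum_cup_update hA (hF' i) hl hmem).trans ih)
      congr 3
      funext j
      by_cases hj : j = i
      · subst hj
        rw [Function.update_self, if_pos (Finset.mem_insert_self _ _)]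
      · simp [hj]
  simpa using (key Finset.univ).symm

theorem boxSum_cup_eq_one {N : ℕ} (hN : 0 < N) {F : ι → (ι → ℕ) → ZMod 2} (hF : Separates N F)
    {l : List ι} (hl : l.Nodup) (hmem : ∀ i, i ∈ l) : boxSum N (cup F l unit) = 1 := by
  have hpos : Separates N (fun (i : ι) (w : ι → ℕ) => if w i = 0 then (0 : ZMod 2) else 1) := by
    intro i v
    refine ⟨fun h => if_pos h, fun h => if_neg ?_⟩
    omega
  rw [boxSum_cup_eq hF hpos hl hmem, boxSum,
    Finset.sum_eq_single_of_mem (0 : ι → ℕ) (by simpa using fun _ => hN)]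
  · rw [cup_positive l hl, if_pos]
    refine ⟨?_, by simp⟩
    ext i
    simp [hmem i]
  · intro v _ hv
    rw [cup_positive l hl, if_neg]
    rintro ⟨-, h⟩
    exact hv (funext fun i => h i (hmem i))

/-- **Kuhn's lemma**: a labelling separating opposite faces of the box has a unit cube on which
no component is constant. -/
theorem exists_cube_of_separates {N : ℕ} (hN : 0 < N) {F : ι → (ι → ℕ) → ZMod 2}
    (hF : Separates N F) :
    ∃ v : ι → ℕ, (∀ k, v k < N) ∧ ∀ i, ∃ r s : ι → ℕ, (∀ k, v k ≤ r k ∧ r k ≤ v k + 1) ∧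
      (∀ k, v k ≤ s k ∧ s k ≤ v k + 1) ∧ F i r = 0 ∧ F i s = 1 := by
  have h : boxSum N (cup F Finset.univ.toList unit) = 1 :=
    boxSum_cup_eq_one hN hF (Finset.nodup_toList _) (by simp)
  obtain ⟨v, hv, hne⟩ := Finset.exists_ne_zero_of_sum_ne_zero (h.trans_ne one_ne_zero)
  refine ⟨v, by simpa using hv, fun i => ?_⟩
  obtain ⟨r, s, hr, hs, hrs⟩ := exists_ne_of_cup_ne_zero hne i (by simp)
  simp only [Finset.mem_univ, if_true] at hr hs
  have h01 : ∀ a b : ZMod 2, a ≠ b → a = 0 ∧ b = 1 ∨ b = 0 ∧ a = 1 := by decide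
  rcases h01 _ _ hrs with h | h
  · exact ⟨r, s, hr, hs, h⟩
  · exact ⟨s, r, hs, hr, h⟩

end GridCochain

theorem stmt9 (n : ℕ)
    (Λ : Set (Fin n → ℝ)) (hΛ : Λ = {x | ∀ k, x k ∈ Icc (-1:ℝ) 1})
    (p : (Fin n → ℝ) → Fin n → ℝ)
    (hp : ContinuousOn p Λ)
    (hpΛ : ∀ x ∈ Λ, p x ∈ Λ)
    (hminus : ∀ k, ∀ x ∈ Λ, x k = -1 → p x k = -1)
    (hplus : ∀ k, ∀ x ∈ Λ, x k = 1 → p x k = 1) :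
    ∀ a ∈ Λ, ∃ c ∈ Λ, p c = a := by
  intro a ha
  have hcomp : IsCompact Λ := by
    have : Λ = Set.univ.pi fun _ => Icc (-1 : ℝ) 1 := by
      ext x
      simp only [hΛ, mem_ofPred_eq, Set.mem_pi, Set.mem_univ, true_imp_iff]
    rw [this]
    exact isCompact_univ_pi fun _ => isCompact_Icc
  have hmem : ∀ x, x ∈ Λ ↔ ∀ k, x k ∈ Icc (-1 : ℝ) 1 := fun x => by rw [hΛ]; rfl
  suffices a ∈ closure (p '' Λ) by
    rwa [(hcomp.image_of_continuousOn hp).isClosed.closure_eq] at this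
  rw [Metric.mem_closure_iff]
  intro ε hε
  obtain ⟨δ, hδ, hpδ⟩ := Metric.uniformContinuousOn_iff.1
    (hcomp.uniformContinuousOn_of_continuous hp) ε hε
  obtain ⟨N, hN⟩ := exists_nat_gt (2 / δ)
  have hN0 : (0 : ℝ) < N := lt_trans (by positivity) hN
  have hN' : 2 / (N : ℝ) < δ := by
    rw [div_lt_iff₀ hδ] at hN
    rw [div_lt_iff₀ hN0]
    linarith
  let X : (Fin n → ℕ) → Fin n → ℝ := fun v k => -1 + 2 / N * v k
  have hX : ∀ v : Fin n → ℕ, (∀ k, v k ≤ N) → X v ∈ Λ := by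
    intro v hv
    rw [hmem]
    intro k
    have h1 : (v k : ℝ) ≤ N := by exact_mod_cast hv k
    have h2 : 2 / (N : ℝ) * v k ≤ 2 / N * N := by gcongr
    rw [div_mul_cancel₀ _ hN0.ne'] at h2
    have h3 : 0 ≤ 2 / (N : ℝ) * v k := by positivity
    simp only [X, mem_Icc]
    constructor <;> linarith
  classical
  let F : Fin n → (Fin n → ℕ) → ZMod 2 := fun i v =>
    if v i = 0 then 0 else if v i = N then 1 else if p (X v) i < a i then 0 else 1
  have hF : GridCochain.Separates N F := by
    intro i v
    have : N ≠ 0 := by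
      rintro rfl
      simp at hN0
    constructor
    · intro h
      simp [F, h]
    · intro h
      simp [F, h, this]
  have ha' := (hmem a).1 ha
  have hF0 : ∀ i v, (∀ k, v k ≤ N) → F i v = 0 → p (X v) i ≤ a i := by
    intro i v hv h
    simp only [F] at h
    split_ifs at h with h1 h2 h3
    · rw [hminus i _ (hX v hv) (by simp [X, h1])]
      exact (ha' i).1
    · exact absurd h one_ne_zero
    · exact h3.le
    · exact absurd h one_ne_zero
  have hF1 : ∀ i v, (∀ k, v k ≤ N) → F i v = 1 → a i ≤ p (X v) i := by
    intro i v hv h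
    simp only [F] at h
    split_ifs at h with h1 h2 h3
    · simp at h
    · rw [hplus i _ (hX v hv) (by simp only [X, h2]; rw [div_mul_cancel₀ _ hN0.ne']; norm_num)]
      exact (ha' i).2
    · simp at h
    · exact not_lt.1 h3
  obtain ⟨v, hv, hcube⟩ := GridCochain.exists_cube_of_separates (by exact_mod_cast hN0) hF
  have hvN : ∀ k, v k ≤ N := fun k => (hv k).le
  have hclose : ∀ r : Fin n → ℕ, (∀ k, v k ≤ r k ∧ r k ≤ v k + 1) →
      (∀ k, r k ≤ N) ∧ ∀ i, |p (X r) i - p (X v) i| < ε := by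
    intro r hr
    have hrN : ∀ k, r k ≤ N := fun k => (hr k).2.trans (hv k)
    refine ⟨hrN, fun i => ?_⟩
    have hd : dist (X r) (X v) < δ := by
      refine lt_of_le_of_lt ((dist_pi_le_iff (by positivity)).2 fun k => ?_) hN'
      have h1 : (v k : ℝ) ≤ r k := by exact_mod_cast (hr k).1
      have h2 : (r k : ℝ) ≤ v k + 1 := by exact_mod_cast (hr k).2
      have h3 : X r k - X v k = 2 / N * ((r k : ℝ) - v k) := by simp only [X]; ring
      rw [Real.dist_eq, h3, abs_of_nonneg (mul_nonneg (by positivity) (by linarith))]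
      exact mul_le_of_le_one_right (by positivity) (by linarith)
    exact lt_of_le_of_lt (dist_le_pi_dist (p (X r)) (p (X v)) i)
      (hpδ _ (hX r hrN) _ (hX v hvN) hd)
  refine ⟨p (X v), mem_image_of_mem p (hX v hvN), (dist_pi_lt_iff hε).2 fun i => ?_⟩
  obtain ⟨r, s, hr, hs, hr0, hs1⟩ := hcube i
  have h1 := hF0 i r (hclose r hr).1 hr0
  have h2 := hF1 i s (hclose s hs).1 hs1
  have h3 := abs_lt.1 ((hclose r hr).2 i)
  have h4 := abs_lt.1 ((hclose s hs).2 i)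
  rw [Real.dist_eq, abs_lt]
  constructor <;> linarith
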